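/- arXiv:2302.00964 — 2 statements merged into one kernel-verified Lean document; each statement's English description precedes it below -/
import Mathlib

section
/- For every integer n ≥ 0, δ₄(n) = (1/4)·Σ_{(a,b) ∈ ℕ², a+2b=n} r₂(a)·r₂(8b + 2). -/
/-- `deltaRep k c n` is the number of `k`-tuples `(x₁, …, x_k)` of nonnegative integers
with `n = Σᵢ cᵢ · xᵢ(xᵢ+1)/2`. -/
noncomputable def deltaRep (k : ℕ) (c : Fin k → ℕ) (n : ℕ) : ℕ :=
  Set.ncard {x : Fin k → ℕ | n = ∑ i, c i * (x i * (x i + 1) / 2)}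

/-- `rRep v b n` is the number of `v`-tuples `(y₁, …, y_v)` of integers with
`n = Σᵢ bᵢ · yᵢ²`. -/
noncomputable def rRep (v : ℕ) (b : Fin v → ℕ) (n : ℕ) : ℕ :=
  Set.ncard {y : Fin v → ℤ | (n : ℤ) = ∑ i, (b i : ℤ) * y i ^ 2}

/-- `qRep k c n` is the number of `k`-tuples `(y₁, …, y_k)` of positive odd integers with
`n = Σᵢ cᵢ · yᵢ²`. -/
noncomputable def qRep (k : ℕ) (c : Fin k → ℕ) (n : ℕ) : ℕ :=
  Set.ncard {y : Fin k → ℕ | (∀ i, 0 < y i ∧ Odd (y i)) ∧ n = ∑ i, c i * y i ^ 2}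

/-- `NstRep v k b c n` is the number of pairs of tuples `((y₁, …, y_v), (z₁, …, z_k))`
with the `yᵢ` integers and the `z_j` nonnegative integers such that
`n = Σᵢ bᵢ·yᵢ² + Σⱼ cⱼ·zⱼ(zⱼ+1)/2`. -/
noncomputable def NstRep (v k : ℕ) (b : Fin v → ℕ) (c : Fin k → ℕ) (n : ℕ) : ℕ :=
  Set.ncard {p : (Fin v → ℤ) × (Fin k → ℕ) |
    (n : ℤ) = ∑ i, (b i : ℤ) * p.1 i ^ 2 +
      ∑ j, (c j : ℤ) * ((p.2 j * (p.2 j + 1) / 2 : ℕ) : ℤ)}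

/-- The finite set of pairs `(a, b)` of nonnegative integers with `a + 2b = n`. -/
def convPairs (n : ℕ) : Finset (ℕ × ℕ) :=
  (Finset.range (n + 1) ×ˢ Finset.range (n + 1)).filter fun p => p.1 + 2 * p.2 = n

/-- The triangular-number index of an integer: `w` and `-w - 1` have the same index. -/
def triIndex (w : ℤ) : ℕ := if 0 ≤ w then w.toNat else (-w - 1).toNat

/-- The integer with given triangular-number index and sign. -/
def ofTriIndex (t : ℕ) (s : Bool) : ℤ := if s then t else -t - 1

lemma triIndex_ofTriIndex (t : ℕ) (s : Bool) : triIndex (ofTriIndex t s) = t := by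
  unfold triIndex ofTriIndex
  cases s <;> grind

lemma ofTriIndex_triIndex (w : ℤ) : ofTriIndex (triIndex w) (decide (0 ≤ w)) = w := by
  unfold triIndex ofTriIndex
  by_cases h : 0 ≤ w <;> simp only [h] <;> grind

lemma nonneg_ofTriIndex (t : ℕ) (s : Bool) : decide (0 ≤ ofTriIndex t s) = s := by
  unfold ofTriIndex
  cases s <;> grind

lemma triIndex_mul_succ (w : ℤ) :
    (triIndex w : ℤ) * (triIndex w + 1) = w * (w + 1) := by
  rcases lt_or_ge w 0 with h | h
  · have : (triIndex w : ℤ) = -w - 1 := by unfold triIndex; split_ifs <;> omega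
    rw [this]; ring
  · have : (triIndex w : ℤ) = w := by simp [triIndex, h]
    rw [this]

lemma ofTriIndex_mul_succ (t : ℕ) (s : Bool) :
    ofTriIndex t s * (ofTriIndex t s + 1) = (t : ℤ) * (t + 1) := by
  rw [← triIndex_mul_succ, triIndex_ofTriIndex]

lemma two_mul_triangular (t : ℕ) : 2 * (((t * (t + 1) / 2 : ℕ)) : ℤ) = (t : ℤ) * (t + 1) := by
  have h := Nat.mul_div_cancel' (Nat.even_mul_succ_self t).two_dvd
  exact_mod_cast h

lemma two_mul_sum_triangular_iff (t u b : ℕ) :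
    b = t * (t + 1) / 2 + u * (u + 1) / 2 ↔
      2 * (b : ℤ) = (t : ℤ) * (t + 1) + (u : ℤ) * (u + 1) := by
  have h₁ := two_mul_triangular t
  have h₂ := two_mul_triangular u
  omega

lemma odd_of_sq_add_sq_eq {b : ℕ} {y z : ℤ} (h : ((8 * b + 2 : ℕ) : ℤ) = y ^ 2 + z ^ 2) :
    y % 2 = 1 ∧ z % 2 = 1 := by
  have key : ∀ y z : ZMod 4, y ^ 2 + z ^ 2 = 2 → (y = 1 ∨ y = 3) ∧ (z = 1 ∨ z = 3) := by decide
  have h4 : ((y : ℤ) : ZMod 4) ^ 2 + ((z : ℤ) : ZMod 4) ^ 2 = 2 := by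
    have := congrArg (Int.cast : ℤ → ZMod 4) h
    push_cast at this
    rw [← this, show (8 : ZMod 4) = 0 from rfl]
    ring
  have odd : ∀ w : ℤ, ((w : ZMod 4) = 1 ∨ (w : ZMod 4) = 3) → w % 2 = 1 := by
    rintro w (hw | hw)
    · have := (ZMod.intCast_eq_intCast_iff_dvd_sub 1 w 4).1 (by simpa using hw.symm)
      omega
    · have := (ZMod.intCast_eq_intCast_iff_dvd_sub 3 w 4).1 (by simpa using hw.symm)
      omega
  exact ⟨odd y (key _ _ h4).1, odd z (key _ _ h4).2⟩

/-- Representations of `8b + 2` by two squares are pairs of triangular numbers summing to `b`,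
with two signs. -/
def sqPairEquiv (b : ℕ) :
    {y : Fin 2 → ℤ // ((8 * b + 2 : ℕ) : ℤ) = ∑ i, ((1 : ℕ) : ℤ) * y i ^ 2} ≃
      {t : Fin 2 → ℕ // b = ∑ i, 1 * (t i * (t i + 1) / 2)} × (Fin 2 → Bool) where
  toFun y := (⟨fun i => triIndex ((y.1 i - 1) / 2), by
    have h := y.2
    simp only [Fin.sum_univ_two, Nat.cast_one, one_mul] at h ⊢
    obtain ⟨h₀, h₁⟩ := odd_of_sq_add_sq_eq h
    rw [two_mul_sum_triangular_iff, triIndex_mul_succ, triIndex_mul_succ]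
    obtain ⟨v, hv⟩ : ∃ v, y.1 0 = 2 * v + 1 := ⟨(y.1 0 - 1) / 2, by omega⟩
    obtain ⟨w, hw⟩ : ∃ w, y.1 1 = 2 * w + 1 := ⟨(y.1 1 - 1) / 2, by omega⟩
    rw [hv, hw] at h ⊢
    rw [show (2 * v + 1 - 1) / 2 = v by omega, show (2 * w + 1 - 1) / 2 = w by omega]
    push_cast at h
    linarith⟩, fun i => decide (0 ≤ (y.1 i - 1) / 2))
  invFun p := ⟨fun i => 2 * ofTriIndex (p.1.1 i) (p.2 i) + 1, by
    have h := p.1.2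
    simp only [Fin.sum_univ_two, Nat.cast_one, one_mul] at h ⊢
    rw [two_mul_sum_triangular_iff, ← ofTriIndex_mul_succ _ (p.2 0),
      ← ofTriIndex_mul_succ _ (p.2 1)] at h
    push_cast
    linarith⟩
  left_inv y := by
    have h := y.2
    simp only [Fin.sum_univ_two, Nat.cast_one, one_mul] at h
    obtain ⟨h₀, h₁⟩ := odd_of_sq_add_sq_eq h
    ext i
    simp only [ofTriIndex_triIndex]
    fin_cases i <;> simp <;> omega
  right_inv p := by
    ext i <;> simp [triIndex_ofTriIndex, nonneg_ofTriIndex]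

lemma rRep_two_eq_four_mul_deltaRep_two (b : ℕ) :
    rRep 2 (fun _ => 1) (8 * b + 2) = 4 * deltaRep 2 (fun _ => 1) b := by
  have h := Nat.card_congr (sqPairEquiv b)
  rw [Nat.card_prod, Nat.card_eq_fintype_card (α := Fin 2 → Bool)] at h
  simp only [Fintype.card_fun, Fintype.card_bool, Fintype.card_fin] at h
  unfold rRep deltaRep
  rw [← Nat.card_coe_set_eq, ← Nat.card_coe_set_eq]
  exact h.trans (mul_comm _ 4)

lemma finite_sum_sq_eq (v n : ℕ) :
    {y : Fin v → ℤ | (n : ℤ) = ∑ i, ((1 : ℕ) : ℤ) * y i ^ 2}.Finite := by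
  refine (Set.finite_Icc (fun _ => -(n : ℤ)) (fun _ => (n : ℤ))).subset fun y hy => ?_
  have hle : ∀ i, y i ^ 2 ≤ n := fun i => by
    rw [Set.mem_ofPred_eq] at hy
    simp only [Nat.cast_one, one_mul] at hy
    rw [hy]
    exact Finset.single_le_sum (f := fun i => y i ^ 2) (fun j _ => sq_nonneg _) (Finset.mem_univ i)
  exact ⟨fun i => by change -(n : ℤ) ≤ y i; nlinarith [hle i],
    fun i => by change y i ≤ (n : ℤ); nlinarith [hle i]⟩

lemma finite_sum_triangular_eq (k n : ℕ) :
    {t : Fin k → ℕ | n = ∑ i, 1 * (t i * (t i + 1) / 2)}.Finite := by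
  refine (Set.finite_Icc (fun _ => 0) (fun _ => n)).subset fun t ht => ?_
  refine ⟨fun i => Nat.zero_le _, fun i => ?_⟩
  rw [Set.mem_ofPred_eq] at ht
  have h : t i * (t i + 1) / 2 ≤ n := by
    simp only [one_mul] at ht
    rw [ht]
    exact Finset.single_le_sum (f := fun i => t i * (t i + 1) / 2) (fun j _ => Nat.zero_le _)
      (Finset.mem_univ i)
  have h' := two_mul_triangular (t i)
  change t i ≤ n
  rcases Nat.eq_zero_or_pos (t i) with h₀ | h₀
  · omega
  · zify at h h₀ ⊢
    push_cast at h'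
    nlinarith

/-- Pairs `(x, y)` of naturals correspond to pairs `(s, t)` of an integer and a natural, in such a
way that `x(x+1)/2 + y(y+1)/2 = s² + t(t+1)`. -/
def triPairEquiv : ℕ × ℕ ≃ ℤ × ℕ where
  toFun p :=
    if (p.1 + p.2) % 2 = 0 then (((p.1 : ℤ) - p.2) / 2, (p.1 + p.2) / 2)
    else if p.2 < p.1 then (((p.1 : ℤ) + p.2 + 1) / 2, (p.1 - p.2 - 1) / 2)
    else (-(((p.1 : ℤ) + p.2 + 1) / 2), (p.2 - p.1 - 1) / 2)
  invFun q := (triIndex (q.2 + q.1), triIndex (q.2 - q.1))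
  left_inv p := by
    obtain ⟨x, y⟩ := p
    unfold triIndex
    ext <;> grind
  right_inv q := by
    obtain ⟨s, t⟩ := q
    unfold triIndex
    ext <;> grind

lemma triPairEquiv_spec (p : ℕ × ℕ) :
    (((p.1 * (p.1 + 1) / 2 : ℕ)) : ℤ) + ((p.2 * (p.2 + 1) / 2 : ℕ) : ℤ) =
      (triPairEquiv p).1 ^ 2 + 2 * (((triPairEquiv p).2 * ((triPairEquiv p).2 + 1) / 2 : ℕ) : ℤ) := by
  obtain ⟨q, rfl⟩ := triPairEquiv.symm.surjective p
  rw [Equiv.apply_symm_apply]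
  have h₁ := two_mul_triangular (triIndex (q.2 + q.1))
  have h₂ := two_mul_triangular (triIndex (q.2 - q.1))
  rw [triIndex_mul_succ] at h₁ h₂
  change ((triIndex (q.2 + q.1) * (triIndex (q.2 + q.1) + 1) / 2 : ℕ) : ℤ) +
    ((triIndex (q.2 - q.1) * (triIndex (q.2 - q.1) + 1) / 2 : ℕ) : ℤ) = _
  rw [two_mul_triangular]
  linarith

/-- Quadruples of naturals as two integers and two naturals, by `triPairEquiv` on each half. -/
def triQuadEquiv : (Fin 4 → ℕ) ≃ (Fin 2 → ℤ) × (Fin 2 → ℕ) where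
  toFun x :=
    (![(triPairEquiv (x 0, x 1)).1, (triPairEquiv (x 2, x 3)).1],
      ![(triPairEquiv (x 0, x 1)).2, (triPairEquiv (x 2, x 3)).2])
  invFun q :=
    ![(triPairEquiv.symm (q.1 0, q.2 0)).1, (triPairEquiv.symm (q.1 0, q.2 0)).2,
      (triPairEquiv.symm (q.1 1, q.2 1)).1, (triPairEquiv.symm (q.1 1, q.2 1)).2]
  left_inv x := by
    ext i
    fin_cases i <;> simp
  right_inv q := by
    ext i <;> fin_cases i <;> simp

lemma sum_triangular_eq_triQuadEquiv (x : Fin 4 → ℕ) :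
    ((∑ i, 1 * (x i * (x i + 1) / 2) : ℕ) : ℤ) =
      ∑ i, ((1 : ℕ) : ℤ) * (triQuadEquiv x).1 i ^ 2 +
        2 * ((∑ i, 1 * ((triQuadEquiv x).2 i * ((triQuadEquiv x).2 i + 1) / 2) : ℕ) : ℤ) := by
  have h₁ := triPairEquiv_spec (x 0, x 1)
  have h₂ := triPairEquiv_spec (x 2, x 3)
  simp only [triQuadEquiv, Equiv.coe_fn_mk, Fin.sum_univ_four, Fin.sum_univ_two, one_mul,
    Nat.cast_one, Nat.cast_add, Matrix.cons_val_zero, Matrix.cons_val_one]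
  linarith

lemma mem_convPairs {n : ℕ} {p : ℕ × ℕ} : p ∈ convPairs n ↔ p.1 + 2 * p.2 = n := by
  simp only [convPairs, Finset.mem_filter, Finset.mem_product, Finset.mem_range]
  omega

lemma triRep_sigma_ext {n : ℕ}
    {q r : Σ p : convPairs n,
      {y : Fin 2 → ℤ // (p.1.1 : ℤ) = ∑ i, ((1 : ℕ) : ℤ) * y i ^ 2} ×
        {t : Fin 2 → ℕ // p.1.2 = ∑ i, 1 * (t i * (t i + 1) / 2)}}
    (hy : q.2.1.1 = r.2.1.1) (ht : q.2.2.1 = r.2.2.1) : q = r := by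
  obtain ⟨⟨⟨a, b⟩, hp⟩, ⟨y, hqy⟩, ⟨t, hqt⟩⟩ := q
  obtain ⟨⟨⟨c, d⟩, hr⟩, ⟨z, hrz⟩, ⟨u, hru⟩⟩ := r
  dsimp only at hy ht hqy hqt hrz hru
  subst hy ht
  obtain rfl : a = c := by exact_mod_cast hqy.trans hrz.symm
  obtain rfl : b = d := hqt.trans hru.symm
  rfl

/-- Representations of `n` by four triangular numbers, sorted by the decomposition `n = a + 2b`. -/
def triRepEquiv (n : ℕ) :
    {x : Fin 4 → ℕ // n = ∑ i, 1 * (x i * (x i + 1) / 2)} ≃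
      Σ p : convPairs n,
        {y : Fin 2 → ℤ // (p.1.1 : ℤ) = ∑ i, ((1 : ℕ) : ℤ) * y i ^ 2} ×
          {t : Fin 2 → ℕ // p.1.2 = ∑ i, 1 * (t i * (t i + 1) / 2)} where
  toFun x :=
    have h : 0 ≤ ∑ i, ((1 : ℕ) : ℤ) * (triQuadEquiv x.1).1 i ^ 2 :=
      Finset.sum_nonneg fun i _ => by positivity
    ⟨⟨((∑ i, ((1 : ℕ) : ℤ) * (triQuadEquiv x.1).1 i ^ 2).toNat,
        ∑ i, 1 * ((triQuadEquiv x.1).2 i * ((triQuadEquiv x.1).2 i + 1) / 2)), by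
      have hx := x.2
      have hs := sum_triangular_eq_triQuadEquiv x.1
      rw [← hx] at hs
      rw [mem_convPairs]
      dsimp only
      omega⟩,
      ⟨(triQuadEquiv x.1).1, Int.toNat_of_nonneg h⟩, ⟨(triQuadEquiv x.1).2, rfl⟩⟩
  invFun q := ⟨triQuadEquiv.symm (q.2.1.1, q.2.2.1), by
    have hs := sum_triangular_eq_triQuadEquiv (triQuadEquiv.symm (q.2.1.1, q.2.2.1))
    rw [Equiv.apply_symm_apply] at hs
    dsimp only at hs
    rw [← q.2.1.2, ← q.2.2.2] at hs
    have hp := mem_convPairs.1 q.1.2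
    omega⟩
  left_inv x := by simp
  right_inv q := by
    apply triRep_sigma_ext <;> simp

lemma deltaRep_four_eq_sum (n : ℕ) :
    deltaRep 4 (fun _ => 1) n =
      ∑ p ∈ convPairs n, rRep 2 (fun _ => 1) p.1 * deltaRep 2 (fun _ => 1) p.2 := by
  have hy (a : ℕ) : Finite {y : Fin 2 → ℤ // (a : ℤ) = ∑ i, ((1 : ℕ) : ℤ) * y i ^ 2} :=
    finite_sum_sq_eq 2 a
  have ht (b : ℕ) : Finite {t : Fin 2 → ℕ // b = ∑ i, 1 * (t i * (t i + 1) / 2)} :=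
    finite_sum_triangular_eq 2 b
  have h := Nat.card_congr (triRepEquiv n)
  rw [Nat.card_sigma] at h
  simp only [Nat.card_prod] at h
  rw [← Finset.sum_coe_sort]
  exact h

theorem delta_four_formula (n : ℕ) :
    (deltaRep 4 (fun _ => 1) n : ℚ) =
      (1 / 4) * ∑ p ∈ convPairs n,
        (rRep 2 (fun _ => 1) p.1 : ℚ) * (rRep 2 (fun _ => 1) (8 * p.2 + 2) : ℚ) := by
  rw [deltaRep_four_eq_sum, Finset.mul_sum]
  push_cast
  refine Finset.sum_congr rfl fun p _ => ?_
  rw [rRep_two_eq_four_mul_deltaRep_two]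
  push_cast
  ring
end

section
/- For every integer n ≥ 0, δ₁₂(n) = −(1/8)·Σ_{(a,b) ∈ ℕ², a+2b=n} r₆(a)·(Σ_{d∣(4b+3)} χ₋₄(d)·d²). -/
/-- The quadratic character mod 4: `χ₋₄(m) = 1` if `m ≡ 1 (mod 4)`, `-1` if
`m ≡ 3 (mod 4)`, `0` if `m` is even. -/
def chiNeg4 (m : ℤ) : ℤ :=
  if m % 4 = 1 then 1 else if m % 4 = 3 then -1 else 0

/-- The generating series `∑ₐ X ^ (w a)` of a weight function `w`. -/
noncomputable def weightSeries {α : Type*} (w : α → ℕ) : PowerSeries ℚ :=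
  PowerSeries.mk fun n => ((w ⁻¹' {n}).ncard : ℚ)

theorem weightSeries_comp_equiv {α β : Type*} (e : α ≃ β) (w : β → ℕ) :
    weightSeries (w ∘ e) = weightSeries w := by
  ext n
  simp only [weightSeries, PowerSeries.coeff_mk, Set.preimage_comp]
  rw [Set.ncard_preimage_of_injective_subset_range e.injective (by simp)]

theorem finite_fiber_add {α β : Type*} {w : α → ℕ} {v : β → ℕ}
    (hw : ∀ n, (w ⁻¹' {n}).Finite) (hv : ∀ n, (v ⁻¹' {n}).Finite) (n : ℕ) :
    ((fun p : α × β => w p.1 + v p.2) ⁻¹' {n}).Finite := by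
  refine ((Finset.HasAntidiagonal.antidiagonal n).finite_toSet.biUnion
    fun q _ => (hw q.1).prod (hv q.2)).subset ?_
  intro p hp
  simp only [Set.mem_preimage, Set.mem_singleton_iff] at hp
  simp only [Set.mem_iUnion]
  exact ⟨(w p.1, v p.2), by simpa using hp, by simp⟩

theorem weightSeries_mul {α β : Type*} {w : α → ℕ} {v : β → ℕ}
    (hw : ∀ n, (w ⁻¹' {n}).Finite) (hv : ∀ n, (v ⁻¹' {n}).Finite) :
    weightSeries w * weightSeries v = weightSeries fun p : α × β => w p.1 + v p.2 := by
  classical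
  ext n
  simp only [weightSeries, PowerSeries.coeff_mul, PowerSeries.coeff_mk]
  have hfib : (fun p : α × β => w p.1 + v p.2) ⁻¹' {n} =
      ((Finset.HasAntidiagonal.antidiagonal n).biUnion
        fun q => (hw q.1).toFinset ×ˢ (hv q.2).toFinset : Finset (α × β)) := by
    ext p
    simp only [Set.mem_preimage, Set.mem_singleton_iff, Finset.coe_biUnion, Set.mem_iUnion,
      Finset.mem_coe, Finset.HasAntidiagonal.mem_antidiagonal, Finset.mem_product, Set.Finite.mem_toFinset]
    constructor
    · intro h
      exact ⟨(w p.1, v p.2), h, rfl, rfl⟩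
    · rintro ⟨q, h, h1, h2⟩
      rw [h1, h2, h]
  rw [hfib, Set.ncard_coe_finset, Finset.card_biUnion]
  · push_cast
    refine Finset.sum_congr rfl fun q _ => ?_
    rw [Finset.card_product, Set.ncard_eq_toFinset_card _ (hw q.1),
      Set.ncard_eq_toFinset_card _ (hv q.2)]
    push_cast
    rfl
  · intro a _ b _ hab
    rw [Function.onFun, Finset.disjoint_left]
    intro p hpa hpb
    simp only [Finset.mem_product, Set.Finite.mem_toFinset, Set.mem_preimage,
      Set.mem_singleton_iff] at hpa hpb
    exact hab (Prod.ext (hpa.1.symm.trans hpb.1) (hpa.2.symm.trans hpb.2))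

theorem weightSeries_pow {α : Type*} {w : α → ℕ} (hw : ∀ n, (w ⁻¹' {n}).Finite) (k : ℕ) :
    (∀ n, ((fun x : Fin k → α => ∑ i, w (x i)) ⁻¹' {n}).Finite) ∧
      weightSeries w ^ k = weightSeries fun x : Fin k → α => ∑ i, w (x i) := by
  induction k with
  | zero =>
    refine ⟨fun n => Set.toFinite _, ?_⟩
    ext n
    simp only [weightSeries, pow_zero, PowerSeries.coeff_one, PowerSeries.coeff_mk,
      Finset.univ_eq_empty, Finset.sum_empty]
    split_ifs with h
    · subst h
      simp
    · rw [Set.preimage_const_of_notMem (by simpa using Ne.symm h)]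
      simp
  | succ k ih =>
    have he : (fun x : Fin (k + 1) → α => ∑ i, w (x i)) =
        (fun p : α × (Fin k → α) => w p.1 + ∑ i, w (p.2 i)) ∘
          (Fin.consEquiv fun _ : Fin (k + 1) => α).symm := by
      funext x
      simp [Fin.sum_univ_succ, Fin.consEquiv, Fin.tail]
    refine ⟨fun n => ?_, ?_⟩
    · rw [he, Set.preimage_comp]
      exact (finite_fiber_add hw ih.1 n).preimage (Equiv.injective _).injOn
    · rw [pow_succ', ih.2, weightSeries_mul hw ih.1, he, weightSeries_comp_equiv]

/-- The `x`-th triangular number. -/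
def triangular (x : ℕ) : ℕ := x * (x + 1) / 2

theorem two_mul_triangular_s12 (x : ℕ) : 2 * triangular x = x * (x + 1) :=
  Nat.mul_div_cancel' (Nat.even_mul_succ_self x).two_dvd

theorem two_mul_triangular_cast (x : ℕ) : 2 * (triangular x : ℤ) = x * (x + 1) := by
  exact_mod_cast two_mul_triangular_s12 x

theorem self_le_triangular (x : ℕ) : x ≤ triangular x := by
  have := two_mul_triangular_s12 x
  nlinarith [sq_nonneg ((x : ℤ) - 1), Nat.le_self_pow two_ne_zero x]

theorem finite_fiber_triangular (n : ℕ) : (triangular ⁻¹' {n}).Finite :=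
  (Set.finite_Iic n).subset fun x hx => (self_le_triangular x).trans (le_of_eq hx)

theorem finite_fiber_two_mul_triangular (n : ℕ) :
    ((fun x => 2 * triangular x) ⁻¹' {n}).Finite :=
  (Set.finite_Iic n).subset fun x hx => by
    have h : 2 * triangular x = n := hx
    have := self_le_triangular x
    simp only [Set.mem_Iic]
    omega

theorem finite_fiber_natAbs_sq (n : ℕ) : ((fun y : ℤ => y.natAbs ^ 2) ⁻¹' {n}).Finite :=
  (Set.finite_Icc (-(n : ℤ)) n).subset fun y hy => by
    have h : y.natAbs ^ 2 = n := hy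
    have := Nat.le_self_pow two_ne_zero y.natAbs
    simp only [Set.mem_Icc]
    omega

theorem deltaRep_eq_coeff (k n : ℕ) :
    (deltaRep k (fun _ => 1) n : ℚ) = PowerSeries.coeff n (weightSeries triangular ^ k) := by
  rw [(weightSeries_pow finite_fiber_triangular k).2, weightSeries, PowerSeries.coeff_mk, deltaRep]
  congr 2
  ext x
  simp [triangular, eq_comm]

theorem rRep_eq_coeff (k n : ℕ) :
    (rRep k (fun _ => 1) n : ℚ) =
      PowerSeries.coeff n (weightSeries (fun y : ℤ => y.natAbs ^ 2) ^ k) := by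
  rw [(weightSeries_pow finite_fiber_natAbs_sq k).2, weightSeries, PowerSeries.coeff_mk, rRep]
  congr 2
  ext x
  simp only [Set.mem_ofPred_eq, Set.mem_preimage, Set.mem_singleton_iff]
  zify
  simp [eq_comm]

/-- The pairs `(y, z) ∈ ℤ × ℕ` are matched with `ℕ × ℕ` so that `y² + 2 T(z) = T(x₁) + T(x₂)`. -/
def squareTriangularEquiv : ℕ × ℕ ≃ ℤ × ℕ where
  toFun p :=
    if (p.1 + p.2) % 2 = 0 then (((p.1 : ℤ) - p.2) / 2, (p.1 + p.2) / 2)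
    else if p.2 < p.1 then (((p.1 : ℤ) + p.2 + 1) / 2, (p.1 - p.2 - 1) / 2)
    else (-(((p.1 : ℤ) + p.2 + 1) / 2), (p.2 - p.1 - 1) / 2)
  invFun q :=
    (if 0 ≤ q.2 + q.1 then (q.2 + q.1).toNat else (-(q.2 + q.1) - 1).toNat,
      if 0 ≤ q.2 - q.1 then (q.2 - q.1).toNat else (q.1 - q.2 - 1).toNat)
  left_inv := by
    rintro ⟨a, b⟩
    dsimp only
    split_ifs <;> simp only [Prod.mk.injEq] at * <;> omega
  right_inv := by
    rintro ⟨y, z⟩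
    dsimp only
    split_ifs <;> simp only [Prod.mk.injEq] at * <;> omega

theorem squareTriangularEquiv_symm_weight (q : ℤ × ℕ) :
    triangular (squareTriangularEquiv.symm q).1 + triangular (squareTriangularEquiv.symm q).2 =
      q.1.natAbs ^ 2 + 2 * triangular q.2 := by
  obtain ⟨y, z⟩ := q
  have h1 := two_mul_triangular_cast (squareTriangularEquiv.symm (y, z)).1
  have h2 := two_mul_triangular_cast (squareTriangularEquiv.symm (y, z)).2
  have h3 := two_mul_triangular_cast z
  have e1 : (((squareTriangularEquiv.symm (y, z)).1 : ℕ) : ℤ) = z + y ∨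
      (((squareTriangularEquiv.symm (y, z)).1 : ℕ) : ℤ) = -(z + y) - 1 := by
    simp only [squareTriangularEquiv, Equiv.coe_fn_symm_mk]
    split_ifs <;> omega
  have e2 : (((squareTriangularEquiv.symm (y, z)).2 : ℕ) : ℤ) = z - y ∨
      (((squareTriangularEquiv.symm (y, z)).2 : ℕ) : ℤ) = y - z - 1 := by
    simp only [squareTriangularEquiv, Equiv.coe_fn_symm_mk]
    split_ifs <;> omega
  zify
  rw [sq_abs]
  rcases e1 with e1 | e1 <;> rcases e2 with e2 | e2 <;> rw [e1] at h1 <;> rw [e2] at h2 <;>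
    linarith

theorem weightSeries_triangular_sq :
    weightSeries triangular ^ 2 =
      weightSeries (fun y : ℤ => y.natAbs ^ 2) * weightSeries fun x => 2 * triangular x := by
  rw [sq, weightSeries_mul finite_fiber_triangular finite_fiber_triangular,
    weightSeries_mul finite_fiber_natAbs_sq finite_fiber_two_mul_triangular,
    ← weightSeries_comp_equiv squareTriangularEquiv.symm]
  congr 1
  funext q
  exact squareTriangularEquiv_symm_weight q

theorem coeff_weightSeries_two_mul_triangular_pow (k n : ℕ) :
    PowerSeries.coeff n (weightSeries (fun x => 2 * triangular x) ^ k) =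
      if n % 2 = 0 then (deltaRep k (fun _ => 1) (n / 2) : ℚ) else 0 := by
  rw [(weightSeries_pow finite_fiber_two_mul_triangular k).2, weightSeries, PowerSeries.coeff_mk]
  simp only [← Finset.mul_sum]
  split_ifs with h
  · rw [deltaRep]
    congr 2
    ext x
    simp only [Set.mem_ofPred_eq, Set.mem_preimage, Set.mem_singleton_iff, one_mul, triangular]
    omega
  · rw [Nat.cast_eq_zero]
    refine (congrArg Set.ncard (Set.eq_empty_of_forall_notMem fun x hx => ?_)).trans
      (Set.ncard_empty _)
    simp only [Set.mem_preimage, Set.mem_singleton_iff] at hx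
    omega

theorem deltaRep_twelve_eq_convolution (n : ℕ) :
    (deltaRep 12 (fun _ => 1) n : ℚ) =
      ∑ p ∈ convPairs n, (rRep 6 (fun _ => 1) p.1 : ℚ) * deltaRep 6 (fun _ => 1) p.2 := by
  rw [deltaRep_eq_coeff, show 12 = 2 * 6 from rfl, pow_mul, weightSeries_triangular_sq, mul_pow,
    PowerSeries.coeff_mul]
  simp only [coeff_weightSeries_two_mul_triangular_pow, ← rRep_eq_coeff, mul_ite, mul_zero]
  rw [← Finset.sum_filter]
  refine Finset.sum_nbij' (fun p => (p.1, p.2 / 2)) (fun p => (p.1, 2 * p.2)) ?_ ?_ ?_ ?_ ?_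
  · rintro ⟨a, b⟩
    simp only [Finset.mem_filter, Finset.HasAntidiagonal.mem_antidiagonal, convPairs, Finset.mem_product,
      Finset.mem_range]
    omega
  · rintro ⟨a, b⟩
    simp only [Finset.mem_filter, Finset.HasAntidiagonal.mem_antidiagonal, convPairs, Finset.mem_product,
      Finset.mem_range]
    omega
  · rintro ⟨a, b⟩ h
    have hb : b % 2 = 0 := (Finset.mem_filter.1 h).2
    simp only [Prod.mk.injEq, true_and]
    omega
  · rintro ⟨a, b⟩ _
    simp
  · rintro ⟨a, b⟩ _
    rfl

theorem coeff_mul_derivative_pow_recurrence (f : PowerSeries ℚ) (k n : ℕ) :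
    ∑ p ∈ Finset.HasAntidiagonal.antidiagonal n, PowerSeries.coeff p.1 f *
      (((p.2 : ℚ) - k * p.1) * PowerSeries.coeff p.2 (f ^ k)) = 0 := by
  have hX (g : PowerSeries ℚ) (m : ℕ) :
      PowerSeries.coeff m (PowerSeries.X * PowerSeries.derivative ℚ g) =
        m * PowerSeries.coeff m g := by
    cases m with
    | zero => simp
    | succ m =>
      rw [PowerSeries.coeff_succ_X_mul, PowerSeries.coeff_derivative]
      push_cast
      ring
  have h : f * (PowerSeries.X * PowerSeries.derivative ℚ (f ^ k)) =
      (k : PowerSeries ℚ) * ((PowerSeries.X * PowerSeries.derivative ℚ f) * f ^ k) := by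
    rw [Derivation.leibniz_pow]
    cases k with
    | zero => simp
    | succ k =>
      simp only [Nat.add_sub_cancel, nsmul_eq_mul, smul_eq_mul]
      ring
  have hc := congrArg (PowerSeries.coeff n) h
  rw [← map_natCast (PowerSeries.C (R := ℚ)), PowerSeries.coeff_C_mul, PowerSeries.coeff_mul,
    PowerSeries.coeff_mul, Finset.mul_sum, ← sub_eq_zero, ← Finset.sum_sub_distrib] at hc
  rw [← hc]
  refine Finset.sum_congr rfl fun p _ => ?_
  rw [hX, hX]
  ring

theorem sum_eq_zero_of_neg_involution {α : Type*} {s : Finset α} {f : α → ℤ} (g : α → α)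
    (hs : ∀ a ∈ s, g a ∈ s) (hg : ∀ a, g (g a) = a) (hf : ∀ a ∈ s, f (g a) = -f a) :
    ∑ a ∈ s, f a = 0 := by
  have h : ∑ a ∈ s, f a = ∑ a ∈ s, -f a :=
    Finset.sum_nbij' g g hs hs (fun a _ => hg a) (fun a _ => hg a)
      fun a ha => by rw [hf a ha, neg_neg]
  rw [Finset.sum_neg_distrib] at h
  linarith

theorem chiNeg4_congr {a b : ℤ} (h : a % 4 = b % 4) : chiNeg4 a = chiNeg4 b := by
  simp only [chiNeg4, h]

theorem chiNeg4_neg_of_mod {a b : ℤ} (h : (a + b) % 4 = 0) : chiNeg4 a = -chiNeg4 b := by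
  simp only [chiNeg4]
  split_ifs <;> first | rfl | omega

/-- The integer triples `(y, t, s)` with entries in `[-L, L]` and `y² + t² - s² = M`. -/
noncomputable def hyperboloidTriples (L M : ℤ) : Finset (ℤ × ℤ × ℤ) :=
  (Finset.Icc (-L) L ×ˢ Finset.Icc (-L) L ×ˢ Finset.Icc (-L) L).filter fun a =>
    a.1 ^ 2 + a.2.1 ^ 2 - a.2.2 ^ 2 = M

theorem mem_hyperboloidTriples {L M y t s : ℤ} : (y, t, s) ∈ hyperboloidTriples L M ↔
    ((-L ≤ y ∧ y ≤ L) ∧ (-L ≤ t ∧ t ≤ L) ∧ (-L ≤ s ∧ s ≤ L)) ∧ y ^ 2 + t ^ 2 - s ^ 2 = M := by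
  simp [hyperboloidTriples]

theorem parity_of_hyperboloid {M y t s : ℤ} (hM : M % 8 = 7) (h : y ^ 2 + t ^ 2 - s ^ 2 = M) :
    y % 2 = 0 ∧ t % 2 = 0 ∧ s % 2 = 1 := by
  have key : ∀ y t s : ZMod 8, y ^ 2 + t ^ 2 - s ^ 2 = 7 →
      y.val % 2 = 0 ∧ t.val % 2 = 0 ∧ s.val % 2 = 1 := by decide
  have h8 : ((y : ZMod 8)) ^ 2 + (t : ZMod 8) ^ 2 - (s : ZMod 8) ^ 2 = 7 := by
    have : ((M : ℤ) : ZMod 8) = ((7 : ℤ) : ZMod 8) := by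
      rw [ZMod.intCast_eq_intCast_iff_dvd_sub]
      omega
    rw [← h] at this
    push_cast at this
    exact this
  obtain ⟨h1, h2, h3⟩ := key _ _ _ h8
  have hv (a : ℤ) : (((a : ZMod 8).val : ℕ) : ℤ) = a % 8 := by
    exact_mod_cast ZMod.val_intCast (n := 8) a
  have := hv y
  have := hv t
  have := hv s
  omega

theorem sum_hyperboloidTriples_eq_zero (L M : ℤ) (hM : M % 8 = 7) :
    ∑ a ∈ hyperboloidTriples L M, (chiNeg4 (a.2.1 - a.2.2) *
      (a.2.1 * a.1 * (a.2.1 ^ 2 - a.1 ^ 2)) *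
        ((if a.2.2 < a.2.1 then 1 else 0) * (if -a.1 < a.2.2 then 1 else 0))) = 0 := by
  set c : ℤ × ℤ × ℤ → ℤ := fun a =>
    chiNeg4 (a.2.1 - a.2.2) * (a.2.1 * a.1 * (a.2.1 ^ 2 - a.1 ^ 2)) with hc
  set P : ℤ → ℤ → ℤ := fun s t => if s < t then 1 else 0 with hP
  set Q : ℤ → ℤ → ℤ := fun s y => if -y < s then 1 else 0 with hQ
  have hct : ∀ y t s, (y, t, s) ∈ hyperboloidTriples L M → c (y, -t, s) = -c (y, t, s) := by
    intro y t s h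
    obtain ⟨-, h2, -⟩ := parity_of_hyperboloid hM (mem_hyperboloidTriples.1 h).2
    simp only [hc]
    rw [chiNeg4_congr (show (-t - s) % 4 = (t - s) % 4 by omega)]
    ring
  have hcy : ∀ y t s, c (-y, t, s) = -c (y, t, s) := by
    intro y t s
    simp only [hc]
    ring
  have hcs : ∀ y t s, (y, t, s) ∈ hyperboloidTriples L M → c (y, t, -s) = -c (y, t, s) := by
    intro y t s h
    obtain ⟨-, h2, -⟩ := parity_of_hyperboloid hM (mem_hyperboloidTriples.1 h).2
    simp only [hc]
    rw [chiNeg4_neg_of_mod (show (t - -s + (t - s)) % 4 = 0 by omega)]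
    ring
  have e1 : ∑ a ∈ hyperboloidTriples L M,
      c a * ((P a.2.2 a.2.1 + P a.2.2 (-a.2.1)) * Q a.2.2 a.1) = 0 := by
    refine sum_eq_zero_of_neg_involution (fun a => (a.1, -a.2.1, a.2.2)) ?_ (fun a => by simp) ?_
    · rintro ⟨y, t, s⟩
      simp only [mem_hyperboloidTriples, neg_sq]
      omega
    · rintro ⟨y, t, s⟩ h
      simp only [hct y t s h, neg_neg]
      ring
  have e2 : ∑ a ∈ hyperboloidTriples L M,
      c a * ((P a.2.2 a.2.1 - P a.2.2 (-a.2.1)) * (Q a.2.2 a.1 + Q a.2.2 (-a.1))) = 0 := by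
    refine sum_eq_zero_of_neg_involution (fun a => (-a.1, a.2.1, a.2.2)) ?_ (fun a => by simp) ?_
    · rintro ⟨y, t, s⟩
      simp only [mem_hyperboloidTriples, neg_sq]
      omega
    · rintro ⟨y, t, s⟩ h
      simp only [hcy y t s, neg_neg]
      ring
  have e3 : ∑ a ∈ hyperboloidTriples L M,
      c a * ((P a.2.2 a.2.1 - P a.2.2 (-a.2.1)) * (Q a.2.2 a.1 - Q a.2.2 (-a.1))) = 0 := by
    refine sum_eq_zero_of_neg_involution (fun a => (a.1, a.2.1, -a.2.2)) ?_ (fun a => by simp) ?_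
    · rintro ⟨y, t, s⟩
      simp only [mem_hyperboloidTriples, neg_sq]
      omega
    · rintro ⟨y, t, s⟩ h
      obtain ⟨h1, h2, h3⟩ := parity_of_hyperboloid hM (mem_hyperboloidTriples.1 h).2
      have hPs : P (-s) t - P (-s) (-t) = P s t - P s (-t) := by
        simp only [hP]
        split_ifs <;> omega
      have hQs : Q (-s) y - Q (-s) (-y) = Q s y - Q s (-y) := by
        simp only [hQ]
        split_ifs <;> omega
      simp only [hcs y t s h, hPs, hQs]
      ring
  have h4 : 4 * ∑ a ∈ hyperboloidTriples L M, c a * (P a.2.2 a.2.1 * Q a.2.2 a.1) = 0 := by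
    calc _ = 2 * (∑ a ∈ hyperboloidTriples L M,
            c a * ((P a.2.2 a.2.1 + P a.2.2 (-a.2.1)) * Q a.2.2 a.1)) +
          (∑ a ∈ hyperboloidTriples L M,
            c a * ((P a.2.2 a.2.1 - P a.2.2 (-a.2.1)) * (Q a.2.2 a.1 + Q a.2.2 (-a.1)))) +
          ∑ a ∈ hyperboloidTriples L M,
            c a * ((P a.2.2 a.2.1 - P a.2.2 (-a.2.1)) * (Q a.2.2 a.1 - Q a.2.2 (-a.1))) := by
          rw [Finset.mul_sum, Finset.mul_sum, ← Finset.sum_add_distrib, ← Finset.sum_add_distrib]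
          refine Finset.sum_congr rfl fun a _ => ?_
          ring
      _ = 0 := by rw [e1, e2, e3]; rfl
  linarith

/-- The integer triples `(u, d, e)` with `u² + 2de = M` and `d, e > 0`. -/
noncomputable def factorTriples (M : ℤ) : Finset (ℤ × ℤ × ℤ) :=
  (Finset.Icc (-M) M ×ˢ Finset.Icc 1 M ×ˢ Finset.Icc 1 M).filter fun a =>
    a.1 ^ 2 + 2 * (a.2.1 * a.2.2) = M

theorem mem_factorTriples {M u d e : ℤ} :
    (u, d, e) ∈ factorTriples M ↔ 0 < d ∧ 0 < e ∧ u ^ 2 + 2 * (d * e) = M := by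
  simp only [factorTriples, Finset.mem_filter, Finset.mem_product, Finset.mem_Icc]
  constructor
  · rintro ⟨⟨-, ⟨hd, -⟩, he, -⟩, h⟩
    exact ⟨by omega, by omega, h⟩
  · rintro ⟨hd, he, h⟩
    refine ⟨⟨⟨?_, ?_⟩, ⟨by omega, ?_⟩, by omega, ?_⟩, h⟩ <;>
      nlinarith [sq_nonneg u, sq_nonneg (u - 1), sq_nonneg (u + 1), mul_pos hd he,
        mul_nonneg (sub_nonneg.2 (Int.add_one_le_of_lt hd))
          (sub_nonneg.2 (Int.add_one_le_of_lt he))]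

theorem parity_of_factorTriples {M u d e : ℤ} (hM : M % 8 = 7) (h : u ^ 2 + 2 * (d * e) = M) :
    u % 2 = 1 ∧ (d + e) % 4 = 0 := by
  have key : ∀ u d e : ZMod 8, u ^ 2 + 2 * (d * e) = 7 →
      u.val % 2 = 1 ∧ (d.val + e.val) % 4 = 0 := by decide
  have h8 : ((u : ZMod 8)) ^ 2 + 2 * ((d : ZMod 8) * (e : ZMod 8)) = 7 := by
    have : ((M : ℤ) : ZMod 8) = ((7 : ℤ) : ZMod 8) := by
      rw [ZMod.intCast_eq_intCast_iff_dvd_sub]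
      omega
    rw [← h] at this
    push_cast at this
    exact this
  obtain ⟨h1, h2⟩ := key _ _ _ h8
  have hv (a : ℤ) : (((a : ZMod 8).val : ℕ) : ℤ) = a % 8 := by
    exact_mod_cast ZMod.val_intCast (n := 8) a
  have := hv u
  have := hv d
  have := hv e
  omega

theorem sum_factorTriples_reflected_eq_zero (M : ℤ) (hM : M % 8 = 7) :
    ∑ a ∈ factorTriples M, chiNeg4 a.2.1 * ((a.2.2 - a.1) * (a.1 + a.2.1) *
      ((a.2.2 - a.1) ^ 2 - (a.1 + a.2.1) ^ 2)) = 0 := by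
  rw [← sum_hyperboloidTriples_eq_zero (3 * M) M hM]
  simp only [← ite_and, mul_ite, mul_one, mul_zero]
  rw [← Finset.sum_filter]
  refine Finset.sum_nbij' (fun a => (a.1 + a.2.1, a.2.2 - a.1, a.2.2 - a.1 - a.2.1))
    (fun a => (a.1 + a.2.2 - a.2.1, a.2.1 - a.2.2, a.1 + a.2.2)) ?_ ?_ ?_ ?_ ?_
  · rintro ⟨u, d, e⟩ h
    have hb := h
    simp only [factorTriples, Finset.mem_filter, Finset.mem_product, Finset.mem_Icc] at hb
    rw [mem_factorTriples] at h
    simp only [Finset.mem_filter, mem_hyperboloidTriples]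
    refine ⟨⟨by omega, ?_⟩, by omega, by omega⟩
    rw [← h.2.2]
    ring
  · rintro ⟨y, t, s⟩ h
    simp only [Finset.mem_filter, mem_hyperboloidTriples] at h
    simp only [mem_factorTriples]
    refine ⟨by omega, by omega, ?_⟩
    rw [← h.1.2]
    ring
  · rintro ⟨u, d, e⟩ _
    simp only [Prod.mk.injEq]
    omega
  · rintro ⟨y, t, s⟩ _
    simp only [Prod.mk.injEq]
    omega
  · rintro ⟨u, d, e⟩ _
    simp only
    rw [show e - u - (e - u - d) = d by ring]

theorem sum_factorTriples_eq_zero (M : ℤ) (hM : M % 8 = 7) :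
    ∑ a ∈ factorTriples M,
      chiNeg4 a.2.1 * (a.2.1 ^ 2 * (a.2.1 * a.2.2 - 3 * a.1 ^ 2)) = 0 := by
  have e1 : ∑ a ∈ factorTriples M, chiNeg4 a.2.1 *
      ((a.2.2 - a.1) * (a.1 + a.2.1) * ((a.2.2 - a.1) ^ 2 - (a.1 + a.2.1) ^ 2) -
        (a.2.2 ^ 2 - a.2.1 ^ 2) * (a.2.1 * a.2.2 - 3 * a.1 ^ 2)) = 0 := by
    refine sum_eq_zero_of_neg_involution (fun a => (-a.1, a.2.1, a.2.2)) ?_ (fun a => by simp) ?_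
    · rintro ⟨u, d, e⟩
      simp only [mem_factorTriples, neg_sq]
      exact id
    · rintro ⟨u, d, e⟩ _
      simp only
      ring
  have e2 : ∑ a ∈ factorTriples M, chiNeg4 a.2.1 *
      ((a.2.2 ^ 2 + a.2.1 ^ 2) * (a.2.1 * a.2.2 - 3 * a.1 ^ 2)) = 0 := by
    refine sum_eq_zero_of_neg_involution (fun a => (a.1, a.2.2, a.2.1)) ?_ (fun a => by simp) ?_
    · rintro ⟨u, d, e⟩
      simp only [mem_factorTriples]
      rw [mul_comm e d]
      tauto
    · rintro ⟨u, d, e⟩ h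
      simp only
      rw [chiNeg4_neg_of_mod (parity_of_factorTriples hM (mem_factorTriples.1 h).2.2).2]
      ring
  have h2 : 2 * ∑ a ∈ factorTriples M,
      chiNeg4 a.2.1 * (a.2.1 ^ 2 * (a.2.1 * a.2.2 - 3 * a.1 ^ 2)) = 0 := by
    calc _ = (∑ a ∈ factorTriples M, chiNeg4 a.2.1 *
            ((a.2.2 - a.1) * (a.1 + a.2.1) * ((a.2.2 - a.1) ^ 2 - (a.1 + a.2.1) ^ 2) -
              (a.2.2 ^ 2 - a.2.1 ^ 2) * (a.2.1 * a.2.2 - 3 * a.1 ^ 2))) +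
          (∑ a ∈ factorTriples M, chiNeg4 a.2.1 *
            ((a.2.2 ^ 2 + a.2.1 ^ 2) * (a.2.1 * a.2.2 - 3 * a.1 ^ 2))) -
          ∑ a ∈ factorTriples M, chiNeg4 a.2.1 * ((a.2.2 - a.1) * (a.1 + a.2.1) *
            ((a.2.2 - a.1) ^ 2 - (a.1 + a.2.1) ^ 2)) := by
          rw [Finset.mul_sum, ← Finset.sum_add_distrib, ← Finset.sum_sub_distrib]
          refine Finset.sum_congr rfl fun a _ => ?_
          ring
      _ = 0 := by rw [e1, e2, sum_factorTriples_reflected_eq_zero M hM]; rfl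
  linarith

/-- The twisted divisor sum `∑_{d ∣ 4n+3} χ₋₄(d) d²`. -/
def twistedDivisorSum (n : ℕ) : ℤ :=
  ∑ d ∈ (4 * n + 3).divisors, chiNeg4 (d : ℤ) * (d : ℤ) ^ 2

theorem sum_triangular_twistedDivisorSum (n : ℕ) :
    ∑ x ∈ (Finset.range (n + 1)).filter (fun x => triangular x ≤ n),
      ((n : ℤ) - 7 * triangular x) * twistedDivisorSum (n - triangular x) = 0 := by
  set M : ℤ := 8 * n + 7 with hM
  have hM8 : M % 8 = 7 := by omega
  set F : ℤ × ℤ × ℤ → ℤ := fun a =>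
    chiNeg4 a.2.1 * (a.2.1 ^ 2 * (a.2.1 * a.2.2 - 3 * a.1 ^ 2)) with hF
  have hpos : ∑ a ∈ (factorTriples M).filter (fun a => 0 < a.1), F a = 0 := by
    have hz := sum_factorTriples_eq_zero M hM8
    rw [← Finset.sum_filter_add_sum_filter_not _ fun a : ℤ × ℤ × ℤ => 0 < a.1] at hz
    have hneg : ∑ a ∈ (factorTriples M).filter (fun a => ¬ 0 < a.1), F a =
        ∑ a ∈ (factorTriples M).filter (fun a => 0 < a.1), F a := by
      refine Finset.sum_nbij' (fun a => (-a.1, a.2)) (fun a => (-a.1, a.2)) ?_ ?_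
        (fun a _ => by simp) (fun a _ => by simp) (fun a _ => by simp [hF])
      · rintro ⟨u, d, e⟩
        simp only [Finset.mem_filter, mem_factorTriples, neg_sq]
        rintro ⟨h, hu⟩
        have := parity_of_factorTriples hM8 h.2.2
        exact ⟨h, by omega⟩
      · rintro ⟨u, d, e⟩
        simp only [Finset.mem_filter, mem_factorTriples, neg_sq]
        rintro ⟨h, hu⟩
        exact ⟨h, by omega⟩
    change _ + ∑ a ∈ (factorTriples M).filter (fun a => ¬ 0 < a.1), F a = 0 at hz
    rw [hneg] at hz
    change ∑ a ∈ (factorTriples M).filter (fun a => 0 < a.1), F a + _ = 0 at hz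
    linarith
  have hsum : ∑ x ∈ (Finset.range (n + 1)).filter (fun x => triangular x ≤ n),
      ∑ p ∈ (4 * (n - triangular x) + 3).divisorsAntidiagonal,
        F (2 * (x : ℤ) + 1, (p.1 : ℤ), (p.2 : ℤ)) =
      ∑ a ∈ (factorTriples M).filter (fun a => 0 < a.1), F a := by
    rw [Finset.sum_sigma']
    refine Finset.sum_bij' (fun q _ => (2 * (q.1 : ℤ) + 1, (q.2.1 : ℤ), (q.2.2 : ℤ)))
      (fun a _ => ⟨((a.1 - 1) / 2).toNat, (a.2.1.toNat, a.2.2.toNat)⟩) ?_ ?_ ?_ ?_ ?_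
    · rintro ⟨x, d, e⟩ h
      simp only [Finset.mem_sigma, Finset.mem_filter, Finset.mem_range,
        Nat.mem_divisorsAntidiagonal] at h
      obtain ⟨⟨hx, hT⟩, hde, h0⟩ := h
      have hd : 0 < d := Nat.pos_of_ne_zero fun hd => h0 (by rw [← hde, hd, zero_mul])
      have he : 0 < e := Nat.pos_of_ne_zero fun he => h0 (by rw [← hde, he, mul_zero])
      simp only [Finset.mem_filter, mem_factorTriples]
      refine ⟨⟨by omega, by omega, ?_⟩, by omega⟩
      have hde' : (d : ℤ) * e = 4 * (n - triangular x) + 3 := by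
        rw [← Nat.cast_mul, hde]
        push_cast [hT]
        ring
      rw [hde']
      linarith [two_mul_triangular_cast x]
    · rintro ⟨u, d, e⟩ h
      simp only [Finset.mem_filter, mem_factorTriples] at h
      obtain ⟨⟨hd, he, h⟩, hu⟩ := h
      have hodd := (parity_of_factorTriples hM8 h).1
      obtain ⟨x, rfl⟩ : ∃ x : ℕ, u = 2 * (x : ℤ) + 1 := ⟨((u - 1) / 2).toNat, by omega⟩
      lift d to ℕ using hd.le
      lift e to ℕ using he.le
      have h3 := two_mul_triangular_cast x
      have hde : (d : ℤ) * e = 4 * (n - triangular x) + 3 := by linarith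
      have hT : triangular x ≤ n := by
        have : 0 < (d : ℤ) * e := mul_pos hd he
        omega
      have hx := self_le_triangular x
      have hx' : ((2 * (x : ℤ) + 1 - 1) / 2).toNat = x := by omega
      simp only [Finset.mem_sigma, Finset.mem_filter, Finset.mem_range,
        Nat.mem_divisorsAntidiagonal, hx', Int.toNat_natCast]
      refine ⟨⟨by omega, hT⟩, ?_, by omega⟩
      zify [hT]
      exact hde
    · rintro ⟨x, d, e⟩ _
      simp
    · rintro ⟨u, d, e⟩ h
      simp only [Finset.mem_filter, mem_factorTriples] at h
      have hodd := (parity_of_factorTriples hM8 h.1.2.2).1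
      simp only [Prod.mk.injEq]
      omega
    · rintro ⟨x, d, e⟩ _
      rfl
  rw [hpos] at hsum
  have h4 : 4 * ∑ x ∈ (Finset.range (n + 1)).filter (fun x => triangular x ≤ n),
      ((n : ℤ) - 7 * triangular x) * twistedDivisorSum (n - triangular x) = 0 := by
    rw [← hsum, Finset.mul_sum]
    refine Finset.sum_congr rfl fun x hx => ?_
    have hT := (Finset.mem_filter.1 hx).2
    rw [twistedDivisorSum, ← Nat.sum_divisorsAntidiagonal
      (f := fun d _ => chiNeg4 (d : ℤ) * (d : ℤ) ^ 2), Finset.mul_sum, Finset.mul_sum]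
    refine Finset.sum_congr rfl fun p hp => ?_
    have hde : (p.1 : ℤ) * p.2 = 4 * (n - triangular x) + 3 := by
      rw [← Nat.cast_mul, (Nat.mem_divisorsAntidiagonal.1 hp).1]
      push_cast [hT]
      ring
    simp only [hF, hde]
    linear_combination (-12 * chiNeg4 p.1 * (p.1 : ℤ) ^ 2) * two_mul_triangular_cast x
  linarith

theorem sum_antidiagonal_coeff_triangular (n : ℕ) (g : ℕ → ℕ → ℚ) :
    ∑ p ∈ Finset.HasAntidiagonal.antidiagonal n, PowerSeries.coeff p.1 (weightSeries triangular) * g p.1 p.2 =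
      ∑ x ∈ (Finset.range (n + 1)).filter (fun x => triangular x ≤ n),
        g (triangular x) (n - triangular x) := by
  have hcoeff : ∀ p ∈ Finset.HasAntidiagonal.antidiagonal n,
      PowerSeries.coeff p.1 (weightSeries triangular) * g p.1 p.2 =
        ∑ x ∈ (Finset.range (n + 1)).filter (fun x => triangular x = p.1),
          g (triangular x) (n - triangular x) := by
    rintro ⟨i, j⟩ hp
    rw [Finset.HasAntidiagonal.mem_antidiagonal] at hp
    simp only at hp ⊢
    have hfib : triangular ⁻¹' {i} =
        (((Finset.range (n + 1)).filter fun x => triangular x = i : Finset ℕ) : Set ℕ) := by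
      ext x
      have := self_le_triangular x
      simp only [Set.mem_preimage, Set.mem_singleton_iff, Finset.coe_filter, Finset.mem_range,
        Set.mem_ofPred_eq]
      omega
    rw [weightSeries, PowerSeries.coeff_mk, hfib, Set.ncard_coe_finset, ← nsmul_eq_mul]
    refine (Finset.sum_eq_card_nsmul fun x hx => ?_).symm
    rw [(Finset.mem_filter.1 hx).2, show n - i = j by omega]
  rw [Finset.sum_congr rfl hcoeff, Finset.Nat.sum_antidiagonal_eq_sum_range_succ_mk]
  simp only
  rw [← Finset.sum_fiberwise_of_maps_to (g := triangular) (t := Finset.range n.succ)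
    (s := (Finset.range (n + 1)).filter fun x => triangular x ≤ n)]
  · refine Finset.sum_congr rfl fun i hi => ?_
    rw [Finset.mem_range] at hi
    refine Finset.sum_congr ?_ fun _ _ => rfl
    ext x
    simp only [Finset.mem_filter, Finset.mem_range]
    omega
  · intro x hx
    have := (Finset.mem_filter.1 hx).2
    simp only [Finset.mem_range]
    omega

theorem deltaRep_six (n : ℕ) :
    (deltaRep 6 (fun _ => 1) n : ℚ) = -(1 / 8) * (twistedDivisorSum n : ℚ) := by
  have h00 : triangular 0 = 0 := rfl
  induction n using Nat.strong_induction_on with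
  | _ n ih =>
  rcases Nat.eq_zero_or_pos n with rfl | hn
  · have h0 : PowerSeries.coeff 0 (weightSeries triangular) = 1 := by
      have hfib : triangular ⁻¹' {0} = {0} := by
        ext x
        have := self_le_triangular x
        simp only [Set.mem_preimage, Set.mem_singleton_iff]
        constructor
        · omega
        · rintro rfl
          rfl
      rw [weightSeries, PowerSeries.coeff_mk, hfib, Set.ncard_singleton, Nat.cast_one]
    rw [deltaRep_eq_coeff, PowerSeries.coeff_zero_eq_constantCoeff_apply, map_pow,
      ← PowerSeries.coeff_zero_eq_constantCoeff_apply, h0,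
      show twistedDivisorSum 0 = -8 by decide +kernel]
    norm_num
  · have hrec := coeff_mul_derivative_pow_recurrence (weightSeries triangular) 6 n
    simp only [← deltaRep_eq_coeff] at hrec
    rw [sum_antidiagonal_coeff_triangular n fun i j =>
      ((j : ℚ) - (6 : ℕ) * i) * deltaRep 6 (fun _ => 1) j] at hrec
    have hB : ∑ x ∈ (Finset.range (n + 1)).filter (fun x => triangular x ≤ n),
        (((n - triangular x : ℕ) : ℚ) - (6 : ℕ) * triangular x) *
          (-(1 / 8) * (twistedDivisorSum (n - triangular x) : ℚ)) = 0 := by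
      have h := congrArg (fun z : ℤ => -(1 / 8) * (z : ℚ)) (sum_triangular_twistedDivisorSum n)
      simp only [Int.cast_zero, mul_zero, Int.cast_sum, Finset.mul_sum] at h
      rw [← h]
      refine Finset.sum_congr rfl fun x hx => ?_
      push_cast [(Finset.mem_filter.1 hx).2]
      ring
    have hmem : 0 ∈ (Finset.range (n + 1)).filter fun x => triangular x ≤ n := by
      simp [h00]
    rw [← Finset.add_sum_erase _ _ hmem] at hrec hB
    have htail : ∀ x ∈ ((Finset.range (n + 1)).filter fun x => triangular x ≤ n).erase 0,
        (((n - triangular x : ℕ) : ℚ) - (6 : ℕ) * triangular x) *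
          (deltaRep 6 (fun _ => 1) (n - triangular x) : ℚ) =
        (((n - triangular x : ℕ) : ℚ) - (6 : ℕ) * triangular x) *
          (-(1 / 8) * (twistedDivisorSum (n - triangular x) : ℚ)) := by
      intro x hx
      have hx0 := (Finset.mem_erase.1 hx).1
      have := self_le_triangular x
      rw [ih (n - triangular x) (by omega)]
    rw [Finset.sum_congr rfl htail] at hrec
    have h := add_right_cancel (hrec.trans hB.symm)
    simp only [h00, Nat.sub_zero, Nat.cast_zero, mul_zero, sub_zero] at h
    exact mul_left_cancel₀ (by positivity) h

theorem delta_twelve_formula (n : ℕ) :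
    (deltaRep 12 (fun _ => 1) n : ℚ) =
      -(1 / 8) * ∑ p ∈ convPairs n, (rRep 6 (fun _ => 1) p.1 : ℚ) *
        ((∑ d ∈ (4 * p.2 + 3).divisors, chiNeg4 (d : ℤ) * (d : ℤ) ^ 2 : ℤ) : ℚ) := by
  rw [deltaRep_twelve_eq_convolution, Finset.mul_sum]
  refine Finset.sum_congr rfl fun p _ => ?_
  rw [deltaRep_six, twistedDivisorSum]
  ring
end
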